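/- Let φ ∈ ℝ/ℤ be badly approximable, φ ∈ (3/4, 1), and fix t ∈ ℤ. Then there exist r > 0 and d ∈ ℕ such that for all sufficiently large k, the number of integers s ∈ {1, …, dk} with (t + sk)φ mod 1 ∈ [1−φ, φ] is at least rk. -/

import Mathlib

theorem exists_int_abs_sub_lt_of_fract_notMem_Icc {φ x : ℝ} (hφ : φ < 1)
    (h : Int.fract x ∉ Set.Icc (1 - φ) φ) : ∃ n : ℤ, |x - n| < 1 - φ := by
  have h0 := Int.fract_nonneg x
  have h1 := Int.fract_lt_one x
  have hx := Int.floor_add_fract x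
  rw [Set.mem_Icc, not_and_or, not_le, not_le] at h
  rcases h with h | h
  · exact ⟨⌊x⌋, by rw [abs_lt]; constructor <;> linarith⟩
  · exact ⟨⌊x⌋ + 1, by push_cast; rw [abs_lt]; constructor <;> linarith⟩

/-- A rotation by an angle at distance at least `1/4` from the integers visits the arc
`[1 - φ, φ]` at least once in any three consecutive steps. -/
theorem fract_mem_Icc_or_of_quarter_le {φ x β : ℝ} {b : ℤ} (hφ : φ ∈ Set.Ioo (3/4 : ℝ) 1)
    (hb : 1 / 4 ≤ |β - b|) (hb' : |β - b| ≤ 1 / 2) :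
    Int.fract x ∈ Set.Icc (1 - φ) φ ∨ Int.fract (x + β) ∈ Set.Icc (1 - φ) φ ∨
      Int.fract (x + 2 * β) ∈ Set.Icc (1 - φ) φ := by
  obtain ⟨hφ0, hφ1⟩ := hφ
  by_contra! h
  obtain ⟨n₀, h₀⟩ := exists_int_abs_sub_lt_of_fract_notMem_Icc hφ1 h.1
  obtain ⟨n₁, h₁⟩ := exists_int_abs_sub_lt_of_fract_notMem_Icc hφ1 h.2.1
  obtain ⟨n₂, h₂⟩ := exists_int_abs_sub_lt_of_fract_notMem_Icc hφ1 h.2.2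
  rw [abs_lt] at h₀ h₁ h₂
  rw [abs_le] at hb'
  have eq_of_close : ∀ n : ℤ, -1 < (n : ℝ) → (n : ℝ) < 1 → n = 0 := fun n hn hn' => by
    have hl : -1 < n := by exact_mod_cast hn
    have hu : n < 1 := by exact_mod_cast hn'
    omega
  have e₁ := eq_of_close (n₁ - n₀ - b) (by push_cast; linarith) (by push_cast; linarith)
  have e₂ := eq_of_close (n₂ - n₁ - b) (by push_cast; linarith) (by push_cast; linarith)
  have e : (n₂ : ℝ) = n₀ + 2 * b := by exact_mod_cast (by omega : n₂ = n₀ + 2 * b)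
  rcases le_abs.mp hb with hb | hb <;> linarith

theorem exists_nat_mul_mem_Icc {δ : ℝ} (hδ : 0 < δ) (hδ' : δ ≤ 1 / 2) :
    ∃ m : ℕ, 1 / 4 ≤ m * δ ∧ m * δ ≤ 1 / 2 := by
  have hle : (⌊1 / 2 / δ⌋₊ : ℝ) * δ ≤ 1 / 2 :=
    (le_div_iff₀ hδ).mp (Nat.floor_le (by positivity))
  have hlt : 1 / 2 < ((⌊1 / 2 / δ⌋₊ : ℝ) + 1) * δ :=
    (div_lt_iff₀ hδ).mp (Nat.lt_floor_add_one _)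
  have hone : (1 : ℝ) ≤ ⌊1 / 2 / δ⌋₊ := by
    exact_mod_cast Nat.le_floor (by rw [le_div_iff₀ hδ]; simpa using hδ')
  exact ⟨_, by nlinarith, hle⟩

theorem card_le_three_mul_card_of_add_mem {A S : Finset ℕ} (m : ℕ)
    (h : ∀ s ∈ A, s ∈ S ∨ s + m ∈ S ∨ s + 2 * m ∈ S) : A.card ≤ 3 * S.card := by
  have hsub : A ⊆ S ∪ (S.image (· - m) ∪ S.image (· - 2 * m)) := by
    intro s hs
    simp only [Finset.mem_union, Finset.mem_image]
    rcases h s hs with h | h | h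
    · exact Or.inl h
    · exact Or.inr (Or.inl ⟨_, h, by omega⟩)
    · exact Or.inr (Or.inr ⟨_, h, by omega⟩)
  have h₀ := Finset.card_le_card hsub
  have h₁ := Finset.card_union_le S (S.image (· - m) ∪ S.image (· - 2 * m))
  have h₂ := Finset.card_union_le (S.image (· - m)) (S.image (· - 2 * m))
  have h₃ : (S.image (· - m)).card ≤ S.card := Finset.card_image_le
  have h₄ : (S.image (· - 2 * m)).card ≤ S.card := Finset.card_image_le
  omega

/-- For badly approximable `φ ∈ (3/4,1)` and fixed `t ∈ ℤ`, there are `r > 0`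
and `d ∈ ℕ` such that for all sufficiently large `k`, at least `rk` of the
integers `s ∈ {1,…,dk}` satisfy `(t+sk)φ mod 1 ∈ [1-φ, φ]`. -/
theorem stmt13 (φ : ℝ) (hφ : φ ∈ Set.Ioo (3/4 : ℝ) 1)
    (hba : ∃ c > 0, ∀ (p : ℤ) (q : ℕ), 1 ≤ q → c / (q : ℝ) ^ 2 < |φ - (p : ℝ) / q|)
    (t : ℤ) :
    ∃ r > 0, ∃ d : ℕ, 0 < d ∧ ∃ K : ℕ, ∀ k ≥ K,
      r * k ≤ (((Finset.Icc 1 (d * k)).filter (fun s : ℕ =>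
        Int.fract (((t : ℝ) + (s : ℝ) * k) * φ) ∈ Set.Icc (1 - φ) φ)).card : ℝ) := by
  obtain ⟨c, hc, hba⟩ := hba
  refine ⟨1 / 3, by norm_num, ⌈1 / c⌉₊ + 1, by omega, 1, fun k hk => ?_⟩
  have hk0 : (0 : ℝ) < k := by exact_mod_cast hk
  set p : ℤ := round (k * φ)
  set δ : ℝ := |k * φ - p| with hδ
  have hδc : c < k * δ := by
    have h := hba p k hk
    rw [div_lt_iff₀ (by positivity)] at h
    have e : (k : ℝ) * φ - p = k * (φ - p / k) := by field_simp
    rw [hδ, e, abs_mul, abs_of_pos hk0]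
    linarith
  have hδ0 : 0 < δ := by
    by_contra! h
    nlinarith
  obtain ⟨m, hm, hm'⟩ := exists_nat_mul_mem_Icc hδ0 (abs_sub_round _)
  have habs : |(m : ℝ) * (k * φ) - ((m * p : ℤ) : ℝ)| = m * δ := by
    push_cast
    rw [← mul_sub, abs_mul, Nat.abs_cast]
  have hmk : 2 * m ≤ ⌈1 / c⌉₊ * k := by
    have h₁ : (2 * m : ℝ) * c ≤ k := by
      have h : (m : ℝ) * c ≤ m * (k * δ) := by gcongr
      nlinarith
    have h₂ : (2 * m : ℝ) ≤ 1 / c * k := by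
      rw [div_mul_eq_mul_div, one_mul, le_div_iff₀ hc]
      exact h₁
    have h₃ : (2 * m : ℝ) ≤ ⌈1 / c⌉₊ * k := h₂.trans (by gcongr; exact Nat.le_ceil _)
    exact_mod_cast h₃
  have hcard := card_le_three_mul_card_of_add_mem (A := Finset.Icc 1 k)
    (S := (Finset.Icc 1 ((⌈1 / c⌉₊ + 1) * k)).filter (fun s : ℕ =>
        Int.fract (((t : ℝ) + (s : ℝ) * k) * φ) ∈ Set.Icc (1 - φ) φ)) m (by
    intro s hs
    rw [Finset.mem_Icc] at hs
    have hd : (⌈1 / c⌉₊ + 1) * k = ⌈1 / c⌉₊ * k + k := by ring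
    simp only [Finset.mem_filter, Finset.mem_Icc, hd]
    have e₁ : ((t : ℝ) + ((s + m : ℕ) : ℝ) * k) * φ = (t + s * k) * φ + m * (k * φ) := by
      push_cast; ring
    have e₂ : ((t : ℝ) + ((s + 2 * m : ℕ) : ℝ) * k) * φ =
        (t + s * k) * φ + 2 * (m * (k * φ)) := by
      push_cast; ring
    rw [e₁, e₂]
    rcases fract_mem_Icc_or_of_quarter_le (x := (t + s * k) * φ) hφ
      (hm.trans_eq habs.symm) (habs.trans_le hm') with h | h | h
    · exact Or.inl ⟨by omega, h⟩
    · exact Or.inr (Or.inl ⟨by omega, h⟩)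
    · exact Or.inr (Or.inr ⟨by omega, h⟩))
  rw [Nat.card_Icc, Nat.add_sub_cancel] at hcard
  have hcard' := Nat.cast_le (α := ℝ) |>.mpr hcard
  push_cast at hcard' ⊢
  linarith
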